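/- Let k > 0, m > 0, δ₀ ∈ (0,∞), M > 0, and c > 0 with c < M δ₀^{−m}, and define p(s) := log( ( M Γ(m/k+1) − (M − δ₀^m c) γ(m/k+1, s) ) / s^{m/k} ) for s > 0 and q(s,D) := s δ₀^{−k} D + p(s). Then for every D > 0, the function s ↦ q(s,D) is strictly convex on (0,∞) and attains its unique minimum over (0,∞) at the unique point s₀ > 0 satisfying δ₀^k · p′(s₀) = −D. -/

import Mathlib

open MeasureTheory Real Set
open scoped ENNReal NNReal

/-- The lower incomplete gamma function `γ(a,s) = ∫₀^s t^{a-1} e^{-t} dt`. -/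
noncomputable def lowerGamma (a s : ℝ) : ℝ :=
  ∫ t in (0:ℝ)..s, t ^ (a - 1) * Real.exp (-t)

/-- For `0 < a` the positive root `u` of `a u² + (s - a) u = 1`. -/
noncomputable def quadRoot (a s : ℝ) : ℝ :=
  (a - s + √((s - a) ^ 2 + 4 * a)) / (2 * a)

lemma two_mul_quadRoot {a : ℝ} (ha : 0 < a) (s : ℝ) :
    2 * a * quadRoot a s = a - s + √((s - a) ^ 2 + 4 * a) :=
  mul_div_cancel₀ _ (by positivity)

lemma quadRoot_pos {a : ℝ} (ha : 0 < a) (s : ℝ) : 0 < quadRoot a s := by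
  refine div_pos ?_ (by positivity)
  have : s - a < √((s - a) ^ 2 + 4 * a) := Real.lt_sqrt_of_sq_lt (by linarith)
  linarith

lemma quadRoot_eq {a : ℝ} (ha : 0 < a) (s : ℝ) :
    a * quadRoot a s ^ 2 + (s - a) * quadRoot a s = 1 := by
  have hT := Real.sq_sqrt (show 0 ≤ (s - a) ^ 2 + 4 * a by positivity)
  have hu := two_mul_quadRoot ha s
  rw [eq_sub_of_add_eq' hu.symm] at hT
  refine mul_left_cancel₀ (show 4 * a ≠ 0 by positivity) ?_
  linear_combination hT

lemma quadRoot_le {a s : ℝ} (ha : 0 < a) (hs : 0 < s) : quadRoot a s ≤ (a + 1) / a := by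
  have hT : √((s - a) ^ 2 + 4 * a) ≤ s + a + 2 :=
    Real.sqrt_le_iff.2 ⟨by positivity, by nlinarith [mul_pos ha hs]⟩
  unfold quadRoot
  rw [div_le_div_iff₀ (by positivity) ha]
  nlinarith

lemma hasDerivAt_quadRoot {a : ℝ} (ha : 0 < a) (s : ℝ) :
    HasDerivAt (quadRoot a) (-(quadRoot a s / √((s - a) ^ 2 + 4 * a))) s := by
  have h0 : 0 < (s - a) ^ 2 + 4 * a := by positivity
  have hT : 0 < √((s - a) ^ 2 + 4 * a) := Real.sqrt_pos.2 h0
  have h1 : HasDerivAt (fun x : ℝ => (x - a) ^ 2 + 4 * a) (2 * (s - a)) s := by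
    simpa using ((((hasDerivAt_id s).sub_const a).pow 2).add_const (4 * a))
  have h2 := (((hasDerivAt_id s).const_sub a).add (h1.sqrt h0.ne')).div_const (2 * a)
  refine h2.congr_deriv ?_
  unfold quadRoot
  field_simp
  ring

lemma hasDerivAt_lowerGamma {a : ℝ} (ha : 0 < a) (s : ℝ) :
    HasDerivAt (lowerGamma (a + 1)) (s ^ a * Real.exp (-s)) s := by
  have hc : Continuous fun t : ℝ => t ^ (a + 1 - 1) * Real.exp (-t) := by
    rw [add_sub_cancel_right]
    exact (Real.continuous_rpow_const ha.le).mul (by fun_prop)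
  exact (hc.integral_hasStrictDerivAt 0 s).hasDerivAt.congr_deriv (by rw [add_sub_cancel_right])

lemma tendsto_lowerGamma_atTop {a : ℝ} (ha : 0 < a) :
    Filter.Tendsto (lowerGamma a) Filter.atTop (nhds (Real.Gamma a)) := by
  have hi := Real.GammaIntegral_convergent ha
  rw [Real.Gamma_eq_integral ha]
  simp_rw [mul_comm (Real.exp _)] at hi ⊢
  exact intervalIntegral_tendsto_integral_Ioi 0 hi Filter.tendsto_id

lemma hasDerivAt_rpow_mul_exp_neg {a s : ℝ} (hs : 0 < s) :
    HasDerivAt (fun x : ℝ => x ^ a * Real.exp (-x))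
      (s ^ a * Real.exp (-s) * (a / s - 1)) s := by
  have h := (Real.hasDerivAt_rpow_const (p := a) (Or.inl hs.ne')).mul
    ((hasDerivAt_id s).neg.exp)
  refine h.congr_deriv ?_
  rw [Real.rpow_sub_one hs.ne']
  simp
  field_simp
  ring

lemma tendsto_rpow_mul_exp_neg_atTop (a : ℝ) :
    Filter.Tendsto (fun x : ℝ => x ^ a * Real.exp (-x)) Filter.atTop (nhds 0) := by
  simpa using tendsto_rpow_mul_exp_neg_mul_atTop_nhds_zero a 1 one_pos

/-- A sharp lower bound for the upper incomplete gamma function `Γ(a+1) - γ(a+1,s)`. -/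
lemma lowerGamma_add_le_Gamma {a s : ℝ} (ha : 0 < a) (hs : 0 < s) :
    lowerGamma (a + 1) s + s ^ a * Real.exp (-s) * (s * quadRoot a s) ≤ Real.Gamma (a + 1) := by
  let F : ℝ → ℝ := fun x => lowerGamma (a + 1) x + x ^ a * Real.exp (-x) * (x * quadRoot a x)
  have hderiv : ∀ x, 0 < x → HasDerivAt F (x ^ a * Real.exp (-x) +
      (x ^ a * Real.exp (-x) * (a / x - 1) * (x * quadRoot a x) +
        x ^ a * Real.exp (-x) * (1 * quadRoot a x +
          x * -(quadRoot a x / √((x - a) ^ 2 + 4 * a))))) x := fun x hx =>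
    (hasDerivAt_lowerGamma ha x).add ((hasDerivAt_rpow_mul_exp_neg hx).mul
      ((hasDerivAt_id x).mul (hasDerivAt_quadRoot ha x)))
  have hmono : MonotoneOn F (Ioi 0) := by
    refine monotoneOn_of_deriv_nonneg (convex_Ioi 0)
      (fun x hx => (hderiv x hx).continuousAt.continuousWithinAt)
      (fun x hx => ?_) (fun x hx => ?_) <;> rw [interior_Ioi] at hx
    · exact (hderiv x hx).differentiableAt.differentiableWithinAt
    · have hx : 0 < x := hx
      rw [(hderiv x hx).deriv]
      have h0 : 0 < (x - a) ^ 2 + 4 * a := by positivity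
      set T := √((x - a) ^ 2 + 4 * a)
      have hT : 0 < T := Real.sqrt_pos.2 h0
      have hT2 : T ^ 2 = (x - a) ^ 2 + 4 * a := Real.sq_sqrt h0.le
      have hTd : x - a < T := Real.lt_sqrt_of_sq_lt (by linarith)
      have hu := quadRoot_pos ha x
      have hq := quadRoot_eq ha x
      have hua : 2 * a * quadRoot a x = a - x + T := two_mul_quadRoot ha x
      set u := quadRoot a x
      have hkey : 0 ≤ T * (T - (x - a)) + 2 * (T - (x - a)) - 2 * a := by
        have h1 : (T - (x - a)) * (T + (x - a)) = 4 * a := by linear_combination hT2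
        nlinarith [mul_pos (sub_pos.2 hTd) (show 0 < T + 4 - (x - a) by linarith)]
      have : x ^ a * Real.exp (-x) + (x ^ a * Real.exp (-x) * (a / x - 1) * (x * u) +
          x ^ a * Real.exp (-x) * (1 * u + x * -(u / T))) =
          x ^ a * Real.exp (-x) * u * ((T * (T - (x - a)) + 2 * (T - (x - a)) - 2 * a) /
            (2 * T)) := by
        field_simp
        linear_combination (-2 * T) * hq + u * T * hua
      rw [this]
      positivity
  have hlim : Filter.Tendsto F Filter.atTop (nhds (Real.Gamma (a + 1))) := by
    have h1 := tendsto_lowerGamma_atTop (show 0 < a + 1 by positivity)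
    have h2 : Filter.Tendsto (fun x => x ^ a * Real.exp (-x) * (x * quadRoot a x))
        Filter.atTop (nhds 0) := by
      have h3 := (tendsto_rpow_mul_exp_neg_atTop (a + 1)).mul_const ((a + 1) / a)
      rw [zero_mul] at h3
      refine squeeze_zero' ?_ ?_ h3 <;>
        filter_upwards [Filter.eventually_gt_atTop 0] with x hx
      · have := quadRoot_pos ha x
        positivity
      · rw [Real.rpow_add_one hx.ne']
        have := mul_le_mul_of_nonneg_left (quadRoot_le ha hx)
          (show 0 ≤ x ^ a * Real.exp (-x) * x by positivity)
        linarith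
    simpa using h1.add h2
  refine ge_of_tendsto hlim ?_
  filter_upwards [Filter.eventually_ge_atTop s] with x hx
  exact hmono hs (hs.trans_le hx) hx

section

variable {a A B : ℝ}

lemma sub_mul_lowerGamma_bound {s : ℝ} (ha : 0 < a) (hB : 0 < B) (hs : 0 < s) :
    A - B * Real.Gamma (a + 1) + B * (s ^ a * Real.exp (-s)) * (s * quadRoot a s) ≤
      A - B * lowerGamma (a + 1) s := by
  nlinarith [mul_le_mul_of_nonneg_left (lowerGamma_add_le_Gamma ha hs) hB.le]

lemma sub_mul_lowerGamma_lower {s : ℝ} (ha : 0 < a) (hB : 0 < B) (hs : 0 < s) :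
    A - B * Real.Gamma (a + 1) ≤ A - B * lowerGamma (a + 1) s := by
  have := quadRoot_pos ha s
  have : 0 ≤ B * (s ^ a * Real.exp (-s)) * (s * quadRoot a s) := by positivity
  linarith [sub_mul_lowerGamma_bound (A := A) ha hB hs]

lemma hasDerivAt_log_sub_mul_lowerGamma_div {s : ℝ} (ha : 0 < a) (hB : 0 < B)
    (hAB : B * Real.Gamma (a + 1) < A) (hs : 0 < s) :
    HasDerivAt (fun x => Real.log ((A - B * lowerGamma (a + 1) x) / x ^ a))
      (-(B * (s ^ a * Real.exp (-s)) / (A - B * lowerGamma (a + 1) s)) - a / s) s := by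
  have hN : ∀ x, 0 < x → 0 < A - B * lowerGamma (a + 1) x := fun x hx => by
    linarith [sub_mul_lowerGamma_lower (A := A) ha hB hx]
  have h := ((((hasDerivAt_lowerGamma ha s).const_mul B).const_sub A).log (hN s hs).ne').sub
    ((Real.hasDerivAt_log hs.ne').const_mul a)
  refine (h.congr_of_eventuallyEq ?_).congr_deriv ?_
  · filter_upwards [lt_mem_nhds hs] with x hx
    rw [Real.log_div (hN x hx).ne' (by positivity), Real.log_rpow hx]
    rfl
  · ring

lemma strictMonoOn_logDeriv_sub_mul_lowerGamma (ha : 0 < a) (hB : 0 < B)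
    (hAB : B * Real.Gamma (a + 1) < A) :
    StrictMonoOn (fun s => -(B * (s ^ a * Real.exp (-s)) / (A - B * lowerGamma (a + 1) s)) - a / s)
      (Ioi 0) := by
  have hN : ∀ x, 0 < x → 0 < A - B * lowerGamma (a + 1) x := fun x hx => by
    linarith [sub_mul_lowerGamma_lower (A := A) ha hB hx]
  have hderiv := fun x (hx : 0 < x) =>
    (((hasDerivAt_rpow_mul_exp_neg (a := a) hx).const_mul B).div
      (((hasDerivAt_lowerGamma ha x).const_mul B).const_sub A) (hN x hx).ne').neg.sub
      ((hasDerivAt_const x a).div (hasDerivAt_id x) hx.ne')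
  refine strictMonoOn_of_deriv_pos (convex_Ioi 0)
    (fun x hx => (hderiv x hx).continuousAt.continuousWithinAt) (fun x hx => ?_)
  rw [interior_Ioi] at hx
  have hx : 0 < x := hx
  refine lt_of_lt_of_eq ?_ (hderiv x hx).deriv.symm
  have hψ : 0 < x ^ a * Real.exp (-x) := by positivity
  have hNx := hN x hx
  have hb := sub_mul_lowerGamma_bound (A := A) ha hB hx
  have hu := quadRoot_pos ha x
  have hq := quadRoot_eq ha x
  simp only [id]
  set ψ := x ^ a * Real.exp (-x)
  set N := A - B * lowerGamma (a + 1) x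
  set u := quadRoot a x
  have hw : B * ψ * x * u / N < 1 := by
    rw [div_lt_one hNx]
    linarith
  have hw0 : 0 < B * ψ * x * u / N := by positivity
  have hmain : 0 < (1 - B * ψ * x * u / N) * (a * u ^ 2 + B * ψ * x * u / N) :=
    mul_pos (sub_pos.2 hw) (by positivity)
  have : 0 < (1 - B * ψ * x * u / N) * (a * u ^ 2 + B * ψ * x * u / N) / (x * u) ^ 2 := by
    positivity
  refine lt_of_lt_of_eq this ?_
  field_simp
  linear_combination (-(B * ψ * x * N)) * hq

lemma exists_logDeriv_sub_mul_lowerGamma_eq (ha : 0 < a) (hB : 0 < B)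
    (hAB : B * Real.Gamma (a + 1) < A) {y : ℝ} (hy : y < 0) :
    ∃ s ∈ Ioi (0 : ℝ),
      -(B * (s ^ a * Real.exp (-s)) / (A - B * lowerGamma (a + 1) s)) - a / s = y := by
  have hN : ∀ x, 0 < x → 0 < A - B * lowerGamma (a + 1) x := fun x hx => by
    linarith [sub_mul_lowerGamma_lower (A := A) ha hB hx]
  have hcont : ContinuousOn (fun s => -(B * (s ^ a * Real.exp (-s)) /
      (A - B * lowerGamma (a + 1) s)) - a / s) (Ioi 0) := fun x (hx : 0 < x) =>
    ((((hasDerivAt_rpow_mul_exp_neg (a := a) hx).continuousAt.const_mul B).div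
      (((hasDerivAt_lowerGamma ha x).continuousAt.const_mul B).const_sub A) (hN x hx).ne').neg.sub
      (continuousAt_const.div continuousAt_id hx.ne')).continuousWithinAt
  have hlim : Filter.Tendsto (fun s => -(B * (s ^ a * Real.exp (-s)) /
      (A - B * lowerGamma (a + 1) s)) - a / s) Filter.atTop (nhds 0) := by
    simpa using ((((tendsto_rpow_mul_exp_neg_atTop a).const_mul B).div
      (((tendsto_lowerGamma_atTop (by positivity)).const_mul B).const_sub A)
      (sub_pos.2 hAB).ne').neg.sub (tendsto_const_nhds.div_atTop Filter.tendsto_id))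
  obtain ⟨t, ht, ht0⟩ := ((hlim.eventually (lt_mem_nhds hy)).and
    (Filter.eventually_gt_atTop 0)).exists
  have hr : 0 < a / -y := div_pos ha (neg_pos.2 hy)
  refine isPreconnected_Ioi.intermediate_value (mem_Ioi.2 hr) (mem_Ioi.2 ht0) hcont
    ⟨?_, ht.le⟩
  have h1 : 0 < B * ((a / -y) ^ a * Real.exp (-(a / -y))) /
      (A - B * lowerGamma (a + 1) (a / -y)) := div_pos (by positivity) (hN _ hr)
  have h2 : a / (a / -y) = -y := by field_simp
  simp only [h2]
  linarith

end

/-- With `p(s) = log((M Γ(m/k+1) − (M − δ₀^m c) γ(m/k+1,s)) / s^{m/k})` and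
`q(s,D) = s δ₀^{-k} D + p(s)`, for each `D > 0` the function `s ↦ q(s,D)` is strictly convex
on `(0,∞)` and attains its unique minimum over `(0,∞)` at the unique point `s₀ > 0`
satisfying `δ₀^k p′(s₀) = −D`. -/
theorem stmt8
    (k m δ₀ M c : ℝ) (hk : 0 < k) (hm : 0 < m) (hδ₀ : 0 < δ₀) (hM : 0 < M) (hc : 0 < c)
    (hcsmall : c < M * δ₀ ^ (-m))
    (p : ℝ → ℝ)
    (hp : ∀ s : ℝ, p s =
      Real.log ((M * Real.Gamma (m / k + 1)
        - (M - δ₀ ^ m * c) * lowerGamma (m / k + 1) s) / s ^ (m / k)))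
    (q : ℝ → ℝ → ℝ)
    (hq : ∀ s D : ℝ, q s D = s * δ₀ ^ (-k) * D + p s) :
    ∀ D : ℝ, 0 < D →
      StrictConvexOn ℝ (Set.Ioi 0) (fun s => q s D) ∧
      ∃ s₀ ∈ Set.Ioi (0:ℝ),
        δ₀ ^ k * deriv p s₀ = -D ∧
        (∀ s ∈ Set.Ioi (0:ℝ), δ₀ ^ k * deriv p s = -D → s = s₀) ∧
        (∀ s ∈ Set.Ioi (0:ℝ), s ≠ s₀ → q s₀ D < q s D) := by
  intro D hD
  have ha : 0 < m / k := by positivity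
  have hδm : δ₀ ^ m * c < M := by
    have := mul_lt_mul_of_pos_left hcsmall (Real.rpow_pos_of_pos hδ₀ m)
    rwa [mul_left_comm, ← Real.rpow_add hδ₀, add_neg_cancel, Real.rpow_zero, mul_one] at this
  have hB : 0 < M - δ₀ ^ m * c := sub_pos.2 hδm
  have hAB : (M - δ₀ ^ m * c) * Real.Gamma (m / k + 1) < M * Real.Gamma (m / k + 1) :=
    mul_lt_mul_of_pos_right (sub_lt_self _ (by positivity))
      (Real.Gamma_pos_of_pos (by positivity))
  have hp' : ∀ s, 0 < s → HasDerivAt p _ s := fun s hs =>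
    (funext hp) ▸ hasDerivAt_log_sub_mul_lowerGamma_div ha hB hAB hs
  have hmono : StrictMonoOn (deriv p) (Ioi 0) :=
    (strictMonoOn_logDeriv_sub_mul_lowerGamma ha hB hAB).congr fun s hs => (hp' s hs).deriv.symm
  have hq' : ∀ s, 0 < s → HasDerivAt (fun s => q s D) (δ₀ ^ (-k) * D + deriv p s) s := by
    intro s hs
    simp only [hq]
    exact ((((hasDerivAt_id s).mul_const (δ₀ ^ (-k))).mul_const D).add
      (hp' s hs).differentiableAt.hasDerivAt).congr_deriv (by rw [one_mul])
  have hconv : StrictConvexOn ℝ (Ioi 0) (fun s => q s D) := by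
    refine StrictMonoOn.strictConvexOn_of_deriv (convex_Ioi 0)
      (fun s hs => (hq' s hs).continuousAt.continuousWithinAt) ?_
    rw [interior_Ioi]
    exact (hmono.const_add (δ₀ ^ (-k) * D)).congr fun s hs => (hq' s hs).deriv.symm
  have hδk : δ₀ ^ k * δ₀ ^ (-k) = 1 := by
    rw [← Real.rpow_add hδ₀, add_neg_cancel, Real.rpow_zero]
  have hδk0 : 0 < δ₀ ^ k := by positivity
  have hδk' : 0 < δ₀ ^ (-k) := by positivity
  obtain ⟨s₀, hs₀, h₀⟩ := exists_logDeriv_sub_mul_lowerGamma_eq ha hB hAB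
    (neg_neg_of_pos (mul_pos hδk' hD))
  rw [← (hp' s₀ hs₀).deriv] at h₀
  have hcrit : δ₀ ^ k * deriv p s₀ = -D := by
    rw [h₀]
    linear_combination (-D) * hδk
  have hmin : IsMinOn (fun s => q s D) (Ioi 0) s₀ := by
    refine hconv.convexOn.isMinOn_of_rightDeriv_eq_zero (by rwa [interior_Ioi]) ?_
    rw [(hq' s₀ hs₀).hasDerivWithinAt.derivWithin (uniqueDiffWithinAt_Ioi s₀), h₀, add_neg_cancel]
  refine ⟨hconv, s₀, hs₀, hcrit, fun s hs h => ?_, fun s hs hne => ?_⟩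
  · exact hmono.injOn hs hs₀ (mul_left_cancel₀ hδk0.ne' (h.trans hcrit.symm))
  · refine (hmin hs).lt_of_ne fun heq => hne ?_
    exact hconv.eq_of_isMinOn (fun x hx => heq.ge.trans (hmin hx)) hmin hs hs₀
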